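/- Multivariate Stein identity: if X ∈ ℝᵐ has iid Gaussian components with means θᵢ and common variance σ², and h : ℝᵐ → ℝᵐ is continuously differentiable with suitable integrability and decay, then E[⟨h(X), θ⟩] = E[⟨h(X), X⟩] - σ²·E[∑ᵢ ∂hᵢ(X)/∂xᵢ]. Consequently ⟨h(X),X⟩ - σ²·∑ᵢ ∂hᵢ(X)/∂xᵢ is an unbiased estimator of E[⟨h(X), θ⟩]. -/

import Mathlib

open Real MeasureTheory Filter

/-- Integration by parts in direction `e`. -/
lemma stein_ibp {m : ℕ} (e : Fin m → ℝ) (a a' f f' : (Fin m → ℝ) → ℝ)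
    (h1 : Integrable (fun x => a' x * f x)) (h2 : Integrable (fun x => a x * f' x))
    (h3 : Integrable (fun x => a x * f x))
    (ha : ∀ x, HasLineDerivAt ℝ a (a' x) x e) (hf : ∀ x, HasLineDerivAt ℝ f (f' x) x e) :
    ∫ x, a x * f' x = - ∫ x, a' x * f x :=
  integral_bilinear_hasLineDerivAt_right_eq_neg_left_of_integrable
    (B := ContinuousLinearMap.mul ℝ ℝ) h1 h2 h3 (fun x _ => ha x) (fun x _ => hf x)

lemma stein_arctan_abs_le (s : ℝ) : |arctan s| ≤ 2 := by
  rw [abs_le]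
  have h1 := neg_pi_div_two_lt_arctan s
  have h2 := arctan_lt_pi_div_two s
  have h3 := pi_le_four
  constructor <;> linarith

lemma stein_abs_le (s : ℝ) : |s| ≤ 1 + 2 * (s * arctan s) := by
  have key : ∀ t : ℝ, 0 ≤ t → t ≤ 1 + 2 * (t * arctan t) := by
    intro t ht
    have h0 : 0 ≤ arctan t := arctan_nonneg.2 ht
    rcases le_total t 1 with h | h
    · nlinarith [mul_nonneg ht h0]
    · have h1 : arctan 1 ≤ arctan t := arctan_mono h
      rw [arctan_one] at h1
      have h3 := pi_gt_three
      nlinarith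
  rcases le_total 0 s with h | h
  · rw [abs_of_nonneg h]; exact key s h
  · rw [abs_of_nonpos h]
    have := key (-s) (by linarith)
    rw [arctan_neg] at this
    linarith

lemma stein_arctan_nonneg (s : ℝ) : 0 ≤ s * arctan s := by
  rcases le_total 0 s with h | h
  · exact mul_nonneg h (arctan_nonneg.2 h)
  · exact mul_nonneg_of_nonpos_of_nonpos h (by
      have := arctan_mono h
      rwa [arctan_zero] at this)

/-- cutoff weight -/
noncomputable def steinPsi (ε s : ℝ) : ℝ := arctan s / (1 + ε * s ^ 2)

noncomputable def steinPsi' (ε s : ℝ) : ℝ :=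
  (1 / (1 + s ^ 2) * (1 + ε * s ^ 2) - arctan s * (ε * (2 * s))) / (1 + ε * s ^ 2) ^ 2

lemma steinPsi_hasDerivAt {ε : ℝ} (hε : 0 < ε) (s : ℝ) :
    HasDerivAt (steinPsi ε) (steinPsi' ε s) s := by
  have h1 : HasDerivAt (fun s : ℝ => 1 + ε * s ^ 2) (ε * (2 * s)) s := by
    have := ((hasDerivAt_pow 2 s).const_mul ε).const_add 1
    simpa using this
  exact (hasDerivAt_arctan s).div h1 (by positivity)

lemma steinPsi_cont {ε : ℝ} (hε : 0 < ε) : Continuous (steinPsi ε) :=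
  continuous_arctan.div (by fun_prop) (fun s => by positivity)

lemma steinPsi'_cont {ε : ℝ} (hε : 0 < ε) : Continuous (steinPsi' ε) := by
  unfold steinPsi'
  have := continuous_arctan
  refine Continuous.div (Continuous.sub (Continuous.mul
    (Continuous.div (by fun_prop) (by fun_prop) fun s => by positivity) (by fun_prop))
    (by fun_prop)) (by fun_prop) (fun s => by positivity)

lemma steinPsi_abs_le {ε : ℝ} (hε : 0 < ε) (s : ℝ) : |steinPsi ε s| ≤ 2 := by
  have h : 0 < 1 + ε * s ^ 2 := by positivity
  rw [steinPsi, abs_div, abs_of_pos h, div_le_iff₀ h]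
  nlinarith [stein_arctan_abs_le s, mul_nonneg hε.le (sq_nonneg s)]

lemma stein_aux {ε : ℝ} (hε : 0 < ε) (hε1 : ε ≤ 1) (s : ℝ) : ε * |s| ≤ 1 + ε * s ^ 2 := by
  have : |s| ≤ 1 + s ^ 2 := by nlinarith [sq_abs s, sq_nonneg (|s| - 1), abs_nonneg s]
  nlinarith

lemma steinPsi_mul_abs_le {ε : ℝ} (hε : 0 < ε) (hε1 : ε ≤ 1) (s : ℝ) :
    |s * steinPsi ε s| ≤ 2 / ε := by
  have h : 0 < 1 + ε * s ^ 2 := by positivity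
  rw [steinPsi, ← mul_div_assoc, abs_div, abs_of_pos h, div_le_div_iff₀ h hε, abs_mul]
  have h1 := stein_arctan_abs_le s
  have h2 := stein_aux hε hε1 s
  have h3 : 0 ≤ ε * |s| := by positivity
  nlinarith [abs_nonneg (arctan s)]

lemma steinPsi'_abs_le {ε : ℝ} (hε : 0 < ε) (hε1 : ε ≤ 1) (s : ℝ) :
    |steinPsi' ε s| ≤ 5 := by
  have h : 0 < 1 + ε * s ^ 2 := by positivity
  have hq : 1 ≤ 1 + ε * s ^ 2 := by nlinarith [mul_nonneg hε.le (sq_nonneg s)]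
  rw [steinPsi', abs_div, abs_of_pos (pow_pos h 2), div_le_iff₀ (pow_pos h 2)]
  have h1 := stein_arctan_abs_le s
  have h2 := stein_aux hε hε1 s
  have h3 : 0 ≤ ε * |s| := by positivity
  have h4 : 1 / (1 + s ^ 2) ≤ 1 := by
    rw [div_le_one (by positivity)]; nlinarith [sq_nonneg s]
  have h5 : 0 ≤ 1 / (1 + s ^ 2) := by positivity
  have h6 : |arctan s * (ε * (2 * s))| ≤ 4 * (1 + ε * s ^ 2) := by
    rw [abs_mul, abs_mul, abs_mul, abs_of_pos hε, abs_of_pos (two_pos (α := ℝ))]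
    nlinarith [abs_nonneg (arctan s)]
  have h7 : |1 / (1 + s ^ 2) * (1 + ε * s ^ 2)| ≤ 1 + ε * s ^ 2 := by
    rw [abs_of_nonneg (by positivity)]; nlinarith
  have h8 := abs_sub (1 / (1 + s ^ 2) * (1 + ε * s ^ 2)) (arctan s * (ε * (2 * s)))
  nlinarith

lemma stein_key {m : ℕ} (e : Fin m → ℝ) (σ : ℝ) (hσ : 0 < σ) (f h D s : (Fin m → ℝ) → ℝ)
    (f0 : ∀ x, 0 ≤ f x) (fc : Continuous f) (hc : Continuous h) (Dc : Continuous D)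
    (sc : Continuous s)
    (fi : Integrable f) (hfi : Integrable (fun x => |h x| * f x))
    (Dfi : Integrable (fun x => |D x| * f x))
    (sd : ∀ x, HasLineDerivAt ℝ s 1 x e)
    (hd : ∀ x, HasLineDerivAt ℝ h (D x) x e)
    (fd : ∀ x, HasLineDerivAt ℝ f (-(s x / σ ^ 2) * f x) x e) :
    Integrable (fun x => h x * s x * f x) ∧ Integrable (fun x => D x * f x) ∧
      Integrable (fun x => h x * f x) ∧
      ∫ x, h x * s x * f x = σ ^ 2 * ∫ x, D x * f x := by
  set u : (Fin m → ℝ) → ℝ := fun x => √(1 + h x ^ 2) with hu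
  set u' : (Fin m → ℝ) → ℝ := fun x => h x * D x / √(1 + h x ^ 2) with hu'
  have upos : ∀ x, 0 < u x := fun x => Real.sqrt_pos.2 (by positivity)
  have hle : ∀ x, |h x| ≤ u x := fun x => Real.abs_le_sqrt (by linarith)
  have ule : ∀ x, u x ≤ 1 + |h x| := fun x =>
    Real.sqrt_le_iff.2 ⟨by positivity, by nlinarith [sq_abs (h x), abs_nonneg (h x)]⟩
  have uc : Continuous u := by fun_prop
  have u'c : Continuous u' := (hc.mul Dc).div uc (fun x => (upos x).ne')
  have u'le : ∀ x, |u' x| ≤ |D x| := by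
    intro x
    show |h x * D x / u x| ≤ _
    rw [abs_div, abs_of_pos (upos x), div_le_iff₀ (upos x), abs_mul]
    nlinarith [hle x, abs_nonneg (D x)]
  have ud : ∀ x, HasLineDerivAt ℝ u (u' x) x e := by
    intro x
    have h1 : HasDerivAt (fun t : ℝ => h (x + t • e)) (D x) 0 := hd x
    have h2 := ((h1.pow 2).const_add 1).sqrt (by
      have : (0 : ℝ) ≤ h (x + (0 : ℝ) • e) ^ 2 := sq_nonneg _
      simp only [Pi.pow_apply]
      linarith)
    refine HasDerivAt.congr_deriv (f := fun t : ℝ => u (x + t • e)) h2 ?_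
    have := (upos x).ne'
    simp only [hu, hu'] at this ⊢
    simp
    field_simp
  have ufi : Integrable (fun x => u x * f x) := by
    refine (fi.add hfi).mono' (by fun_prop) (ae_of_all _ fun x => ?_)
    rw [Real.norm_eq_abs, abs_of_nonneg (mul_nonneg (upos x).le (f0 x))]
    have := mul_le_mul_of_nonneg_right (ule x) (f0 x)
    simp only [Pi.add_apply]; linarith
  have hfi' : Integrable (fun x => h x * f x) := by
    refine hfi.mono' (by fun_prop) (ae_of_all _ fun x => ?_)
    rw [Real.norm_eq_abs, abs_mul, abs_of_nonneg (f0 x)]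
  have Dfi' : Integrable (fun x => D x * f x) := by
    refine Dfi.mono' (by fun_prop) (ae_of_all _ fun x => ?_)
    rw [Real.norm_eq_abs, abs_mul, abs_of_nonneg (f0 x)]
  have u'fi : Integrable (fun x => u' x * f x) := by
    refine Dfi.mono' (by fun_prop) (ae_of_all _ fun x => ?_)
    rw [Real.norm_eq_abs, abs_mul, abs_of_nonneg (f0 x)]
    exact mul_le_mul_of_nonneg_right (u'le x) (f0 x)
  set C : ℝ := ∫ x, (2 * (|D x| * f x) + 5 * (u x * f x)) with hC
  -- the bound
  have bound : ∀ ε : ℝ, 0 < ε → ε ≤ 1 →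
      Integrable (fun x => u x * f x * (s x * steinPsi ε (s x))) ∧
      ∫ x, u x * f x * (s x * steinPsi ε (s x)) ≤ σ ^ 2 * C := by
    intro ε hε hε1
    have pc := (steinPsi_cont hε).comp sc
    have p'c := (steinPsi'_cont hε).comp sc
    simp only [Function.comp_def] at pc p'c
    have i1 : Integrable (fun x => u x * f x * (s x * steinPsi ε (s x))) :=
      ufi.mul_bdd (c := 2 / ε) (by fun_prop)
        (ae_of_all _ fun x => steinPsi_mul_abs_le hε hε1 (s x))
    have i2 : Integrable (fun x => u' x * f x * steinPsi ε (s x)) :=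
      u'fi.mul_bdd (c := 2) pc.aestronglyMeasurable (ae_of_all _ fun x => steinPsi_abs_le hε (s x))
    have i3 : Integrable (fun x => u x * f x * steinPsi' ε (s x)) :=
      ufi.mul_bdd (c := 5) p'c.aestronglyMeasurable (ae_of_all _ fun x => steinPsi'_abs_le hε hε1 (s x))
    have i4 : Integrable (fun x => u x * f x * steinPsi ε (s x)) :=
      ufi.mul_bdd (c := 2) pc.aestronglyMeasurable (ae_of_all _ fun x => steinPsi_abs_le hε (s x))
    have j1 : Integrable (fun x => (u' x * steinPsi ε (s x) + u x * steinPsi' ε (s x)) * f x) :=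
      (i2.add i3).congr (ae_of_all _ fun x => by simp only [Pi.add_apply]; ring)
    have ibp := stein_ibp e (fun x => u x * steinPsi ε (s x))
      (fun x => u' x * steinPsi ε (s x) + u x * steinPsi' ε (s x)) f
      (fun x => -(s x / σ ^ 2) * f x) j1
      ((i1.const_mul (-(1 / σ ^ 2))).congr (ae_of_all _ fun x => by ring))
      (i4.congr (ae_of_all _ fun x => by ring))
      (fun x => by
        have a1 : HasDerivAt (fun t : ℝ => u (x + t • e)) (u' x) 0 := ud x
        have a2 : HasDerivAt (fun t : ℝ => s (x + t • e)) 1 0 := sd x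
        have a3 : HasDerivAt (steinPsi ε) (steinPsi' ε (s x)) (s (x + (0 : ℝ) • e)) := by
          simpa using steinPsi_hasDerivAt hε (s x)
        have a4 := a1.mul (a3.comp 0 a2)
        refine HasDerivAt.congr_deriv
          (f := fun t : ℝ => u (x + t • e) * steinPsi ε (s (x + t • e))) a4 ?_
        simp)
      fd
    refine ⟨i1, ?_⟩
    have e1 : ∫ x, u x * steinPsi ε (s x) * (-(s x / σ ^ 2) * f x)
        = -(1 / σ ^ 2) * ∫ x, u x * f x * (s x * steinPsi ε (s x)) := by
      rw [← integral_const_mul]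
      congr 1; ext x; ring
    rw [e1] at ibp
    have le : ∫ x, (u' x * steinPsi ε (s x) + u x * steinPsi' ε (s x)) * f x ≤ C := by
      refine integral_mono j1 ((Dfi.const_mul 2).add (ufi.const_mul 5)) fun x => ?_
      have b1 : u' x * steinPsi ε (s x) ≤ 2 * |D x| := by
        refine (le_abs_self _).trans ?_
        rw [abs_mul]
        nlinarith [u'le x, steinPsi_abs_le hε (s x), abs_nonneg (u' x),
          abs_nonneg (steinPsi ε (s x)), abs_nonneg (D x)]
      have b2 : u x * steinPsi' ε (s x) ≤ 5 * u x := by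
        nlinarith [upos x, (abs_le.1 (steinPsi'_abs_le hε hε1 (s x))).2]
      have := mul_le_mul_of_nonneg_right (add_le_add b1 b2) (f0 x)
      simp only [Pi.add_apply]
      linarith
    have s2 : 0 < σ ^ 2 := by positivity
    have : ∫ x, u x * f x * (s x * steinPsi ε (s x)) = σ ^ 2 *
        ∫ x, (u' x * steinPsi ε (s x) + u x * steinPsi' ε (s x)) * f x := by
      generalize (∫ x, u x * f x * (s x * steinPsi ε (s x))) = A at ibp ⊢
      field_simp at ibp
      linarith
    rw [this]
    exact mul_le_mul_of_nonneg_left le s2.le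
  have lim : Integrable (fun x => u x * f x * (s x * arctan (s x))) := by
    have ac := continuous_arctan
    refine ⟨by fun_prop, ?_⟩
    have εpos : ∀ n : ℕ, (0 : ℝ) < 1 / ((n : ℝ) + 1) := fun n => by positivity
    have εle : ∀ n : ℕ, 1 / ((n : ℝ) + 1) ≤ 1 := fun n => by
      rw [div_le_one (by positivity)]; linarith [n.cast_nonneg (α := ℝ)]
    have tl : ∀ x, Tendsto (fun n : ℕ => u x * f x * (s x * steinPsi (1 / ((n : ℝ) + 1)) (s x)))
        atTop (nhds (u x * f x * (s x * arctan (s x)))) := by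
      intro x
      refine Tendsto.const_mul _ (Tendsto.const_mul _ ?_)
      have t1 : Tendsto (fun n : ℕ => 1 + 1 / ((n : ℝ) + 1) * s x ^ 2) atTop
          (nhds (1 + 0 * s x ^ 2)) :=
        ((tendsto_one_div_add_atTop_nhds_zero_nat (𝕜 := ℝ)).mul_const _).const_add _
      have t2 := (tendsto_const_nhds (x := arctan (s x))).div t1 (by simp)
      simp only [zero_mul, add_zero, div_one] at t2
      exact t2
    have fatou : ∫⁻ x, ‖u x * f x * (s x * arctan (s x))‖ₑ ≤ liminf (fun n : ℕ =>
        ∫⁻ x, ‖u x * f x * (s x * steinPsi (1 / ((n : ℝ) + 1)) (s x))‖ₑ) atTop := by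
      refine le_trans (le_of_eq ?_) (lintegral_liminf_le'
        fun n => (bound _ (εpos n) (εle n)).1.1.enorm)
      exact lintegral_congr fun x => ((tl x).enorm.liminf_eq).symm
    refine lt_of_le_of_lt fatou ?_
    refine lt_of_le_of_lt (b := ENNReal.ofReal (σ ^ 2 * C)) ?_ ENNReal.ofReal_lt_top
    refine liminf_le_of_le (by isBoundedDefault) fun b hb => ?_
    obtain ⟨n, hn⟩ := hb.exists
    refine hn.trans ?_
    have nn : ∀ x, 0 ≤ u x * f x * (s x * steinPsi (1 / ((n : ℝ) + 1)) (s x)) := fun x => by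
      refine mul_nonneg (mul_nonneg (upos x).le (f0 x)) ?_
      rw [steinPsi, ← mul_div_assoc]
      have := εpos n
      exact div_nonneg (stein_arctan_nonneg _) (by positivity)
    obtain ⟨k1, k2⟩ := bound _ (εpos n) (εle n)
    rw [← ofReal_integral_norm_eq_lintegral_enorm k1]
    refine ENNReal.ofReal_le_ofReal (le_trans (le_of_eq ?_) k2)
    exact integral_congr_ae (ae_of_all _ fun x => by
      simp only [Real.norm_eq_abs]; rw [abs_of_nonneg (nn x)])
  have hsf : Integrable (fun x => h x * s x * f x) := by
    refine (ufi.add (lim.const_mul 2)).mono' (by fun_prop) (ae_of_all _ fun x => ?_)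
    rw [Real.norm_eq_abs, abs_mul, abs_mul, abs_of_nonneg (f0 x)]
    have q1 : |h x| * |s x| ≤ u x * (1 + 2 * (s x * arctan (s x))) :=
      mul_le_mul (hle x) (stein_abs_le _) (abs_nonneg _) (upos x).le
    have := mul_le_mul_of_nonneg_right q1 (f0 x)
    simp only [Pi.add_apply]
    linarith
  refine ⟨hsf, Dfi', hfi', ?_⟩
  have ibp := stein_ibp e h D f (fun x => -(s x / σ ^ 2) * f x) Dfi'
    ((hsf.const_mul (-(1 / σ ^ 2))).congr (ae_of_all _ fun x => by ring)) hfi' hd fd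
  have e1 : ∫ x, h x * (-(s x / σ ^ 2) * f x)
      = -(1 / σ ^ 2) * ∫ x, h x * s x * f x := by
    rw [← integral_const_mul]
    congr 1; ext x; ring
  rw [e1] at ibp
  field_simp at ibp
  linarith

theorem stein_identity_multivariate (m : ℕ) (σ : ℝ) (hσ : 0 < σ) (θ : Fin m → ℝ)
    (f : (Fin m → ℝ) → ℝ)
    (hf : ∀ x, f x = ∏ i, ((2 * π * σ ^ 2) ^ (-(1 : ℝ) / 2) *
      Real.exp (-(x i - θ i) ^ 2 / (2 * σ ^ 2))))
    (h : (Fin m → ℝ) → (Fin m → ℝ))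
    (hh : ContDiff ℝ 1 h)
    (hint1 : ∀ i, Integrable (fun x => |h x i| * f x))
    (hint2 : ∀ i, Integrable
      (fun x => |deriv (fun t => h (Function.update x i t) i) (x i)| * f x))
    (hdecay : ∀ i x, Tendsto
      (fun t : ℝ => h (Function.update x i t) i * f (Function.update x i t))
      (atBot ⊔ atTop) (nhds 0)) :
    ∫ x, (∑ i, h x i * θ i) * f x
      = (∫ x, (∑ i, h x i * x i) * f x)
        - σ ^ 2 * ∫ x, (∑ i, deriv (fun t => h (Function.update x i t) i) (x i)) * f x := by
  have f0 : ∀ x, 0 ≤ f x := fun x => by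
    rw [hf]; exact Finset.prod_nonneg fun i _ => by positivity
  have fc : Continuous f := by
    rw [funext hf]; fun_prop
  have fi : Integrable f := by
    rw [funext hf]
    refine Integrable.fintype_prod (f := fun (i : Fin m) (y : ℝ) =>
      (2 * π * σ ^ 2) ^ (-(1 : ℝ) / 2) * Real.exp (-(y - θ i) ^ 2 / (2 * σ ^ 2))) fun i => ?_
    refine Integrable.const_mul ?_ _
    have := (integrable_exp_neg_mul_sq (b := 1 / (2 * σ ^ 2)) (by positivity)).comp_sub_right (θ i)
    refine this.congr (ae_of_all _ fun y => ?_)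
    simp only
    congr 1; ring
  have fd : ∀ i x, HasLineDerivAt ℝ f (-((x i - θ i) / σ ^ 2) * f x) x (Pi.single i 1) := by
    intro i x
    set K : ℝ := (2 * π * σ ^ 2) ^ (-(1 : ℝ) / 2) with hK
    have fe : ∀ x, f x = K ^ m * Real.exp (∑ j, -(x j - θ j) ^ 2 / (2 * σ ^ 2)) := by
      intro x
      rw [hf, Finset.prod_mul_distrib, Real.exp_sum]
      simp
    have d1 : ∀ j, HasDerivAt (fun t : ℝ => -((x + t • (Pi.single i 1 : Fin m → ℝ)) j - θ j) ^ 2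
        / (2 * σ ^ 2)) (-((x j - θ j) / σ ^ 2) * (Pi.single i 1 : Fin m → ℝ) j) 0 := by
      intro j
      have := (((((hasDerivAt_id (0 : ℝ)).mul_const ((Pi.single i 1 : Fin m → ℝ) j)).const_add
        (x j)).sub_const (θ j)).pow 2).neg.div_const (2 * σ ^ 2)
      refine HasDerivAt.congr_deriv (f := fun t : ℝ =>
        -((x + t • (Pi.single i 1 : Fin m → ℝ)) j - θ j) ^ 2 / (2 * σ ^ 2)) this ?_
      simp
      field_simp
    have d2 := ((HasDerivAt.fun_sum (u := Finset.univ) fun j _ => d1 j).exp).const_mul (K ^ m)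
    show HasDerivAt (fun t : ℝ => f (x + t • (Pi.single i 1 : Fin m → ℝ))) _ 0
    simp only [fe]
    refine d2.congr_deriv ?_
    simp [Pi.single_apply]
    ring
  have hdiff : Differentiable ℝ h := hh.differentiable (by norm_num)
  have hD : ∀ i x, deriv (fun t => h (Function.update x i t) i) (x i)
      = fderiv ℝ h x (Pi.single i 1) i := by
    intro i x
    have h1 : HasFDerivAt h (fderiv ℝ h x) (Function.update x i (x i)) := by
      simpa using (hdiff x).hasFDerivAt
    have h2 := h1.comp_hasDerivAt (x i) (hasDerivAt_update x i (x i))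
    exact ((hasDerivAt_pi.1 h2) i).deriv
  have hc : Continuous h := hh.continuous
  have hfc : Continuous (fderiv ℝ h) := hh.continuous_fderiv (by norm_num)
  have key := fun i => stein_key (Pi.single i 1) σ hσ f (fun x => h x i)
    (fun x => deriv (fun t => h (Function.update x i t) i) (x i)) (fun x => x i - θ i)
    f0 fc (by fun_prop) (by simp only [hD]; fun_prop) (by fun_prop) fi (hint1 i) (hint2 i)
    (fun x => by
      have := (((hasDerivAt_id (0 : ℝ)).mul_const ((Pi.single i 1 : Fin m → ℝ) i)).const_add
        (x i)).sub_const (θ i)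
      refine HasDerivAt.congr_deriv (f := fun t : ℝ =>
        (x + t • (Pi.single i 1 : Fin m → ℝ)) i - θ i) this ?_
      simp)
    (fun x => by
      rw [hD]
      have h1 := ((hdiff x).hasFDerivAt).hasLineDerivAt (Pi.single i 1)
      exact (hasDerivAt_pi.1 h1) i)
    (fd i)
  have hx : ∀ i, Integrable (fun x => h x i * x i * f x) := fun i =>
    ((key i).1.add ((key i).2.2.1.const_mul (θ i))).congr (ae_of_all _ fun x => by
      simp only [Pi.add_apply]; ring)
  have ht : ∀ i, Integrable (fun x => h x i * θ i * f x) := fun i =>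
    ((key i).2.2.1.const_mul (θ i)).congr (ae_of_all _ fun x => by ring)
  simp only [Finset.sum_mul]
  rw [integral_finsetSum _ fun i _ => ht i, integral_finsetSum _ fun i _ => hx i,
    integral_finsetSum _ fun i _ => (key i).2.1, Finset.mul_sum, ← Finset.sum_sub_distrib]
  refine Finset.sum_congr rfl fun i _ => ?_
  rw [← (key i).2.2.2, ← integral_sub (hx i) (key i).1]
  congr 1; ext x; ring
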